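/- If G is a unicyclic graph on an odd number n of vertices that is not a cycle, then T(G) < (n+3)/(n−1) = T(C_n); hence among unicyclic graphs on an odd number of vertices the cycle is the unique graph of maximum tenacity. -/

import Mathlib

open SimpleGraph

/-- Number of connected components `ω(G)`. -/
noncomputable def SimpleGraph.omegaComp {W : Type*} (G : SimpleGraph W) : ℕ :=
  Nat.card G.ConnectedComponent

/-- Order `τ(G)` of a largest connected component of `G`. -/
noncomputable def SimpleGraph.tauMax {W : Type*} (G : SimpleGraph W) : ℕ :=
  sSup (Set.range fun c : G.ConnectedComponent =>
    Nat.card {v : W // G.connectedComponentMk v = c})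

/-- The graph `G - X` obtained by deleting the vertices of `X`. -/
def SimpleGraph.delVerts {V : Type*} (G : SimpleGraph V) (X : Finset V) :
    SimpleGraph {v : V // v ∉ X} :=
  SimpleGraph.comap Subtype.val G

/-- `X` is a vertex cut of `G`: deleting `X` leaves more than one component. -/
def SimpleGraph.IsVertexCut {V : Type*} (G : SimpleGraph V) (X : Finset V) : Prop :=
  1 < (G.delVerts X).omegaComp

/-- The tenacity `T(G) = min over vertex cuts X of (|X| + τ(G−X)) / ω(G−X)`. -/
noncomputable def SimpleGraph.tenacity {V : Type*} [Fintype V] (G : SimpleGraph V) : ℝ :=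
  sInf { t : ℝ | ∃ X : Finset V, G.IsVertexCut X ∧
    t = ((X.card : ℝ) + (G.delVerts X).tauMax) / (G.delVerts X).omegaComp }

/-- Vertex degree via `Nat.card` (no decidability assumptions needed). -/
noncomputable def SimpleGraph.deg {V : Type*} (G : SimpleGraph V) (v : V) : ℕ :=
  Nat.card (G.neighborSet v)

/-- A unicyclic graph: connected with as many edges as vertices. -/
def SimpleGraph.Unicyclic {V : Type*} [Fintype V] (G : SimpleGraph V) : Prop :=
  G.Connected ∧ Nat.card G.edgeSet = Fintype.card V

namespace SimpleGraph

lemma eq_of_reachable {W β : Type*} {H : SimpleGraph W} {g : W → β} (hg : ∀ x y, H.Adj x y → g x = g y) {x y : W}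
    (h : H.Reachable x y) : g x = g y := by
  obtain ⟨p⟩ := h
  induction p with
  | nil => rfl
  | cons hadj _ ih => exact (hg _ _ hadj).trans ih

section Components

variable {W : Type*} [Finite W] (H : SimpleGraph W)

lemma card_component_le_tauMax (c : H.ConnectedComponent) :
    Nat.card {v : W // H.connectedComponentMk v = c} ≤ H.tauMax :=
  le_csSup (Set.finite_range _).bddAbove ⟨c, rfl⟩

lemma omegaComp_le_card : H.omegaComp ≤ Nat.card W :=
  Nat.card_le_card_of_surjective H.connectedComponentMk Quot.mk_surjective

lemma card_le_omegaComp_mul_tauMax : Nat.card W ≤ H.omegaComp * H.tauMax := by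
  have := Fintype.ofFinite H.ConnectedComponent
  rw [← Nat.card_congr (Equiv.sigmaFiberEquiv H.connectedComponentMk), Nat.card_sigma,
    omegaComp, Nat.card_eq_fintype_card, ← smul_eq_mul, ← Finset.card_univ]
  exact Finset.sum_le_card_nsmul _ _ _ fun c _ => H.card_component_le_tauMax c

lemma one_le_tauMax (h : 1 < H.omegaComp) : 1 ≤ H.tauMax := by
  by_contra! h0
  have := H.card_le_omegaComp_mul_tauMax
  have := H.omegaComp_le_card
  simp_all

variable {H}

lemma card_le_omegaComp {β : Type*} {g : W → β} (hg : ∀ x y, H.Adj x y → g x = g y)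
    (s : Finset W) (hs : Set.InjOn g s) : s.card ≤ H.omegaComp := by
  rw [omegaComp, ← Nat.card_eq_finsetCard s]
  refine Nat.card_le_card_of_injective (fun v : s => H.connectedComponentMk v) fun x y hxy => ?_
  exact Subtype.ext (hs x.2 y.2 (eq_of_reachable hg (ConnectedComponent.exact hxy)))

lemma tauMax_le {β : Type*} {g : W → β} (hg : ∀ x y, H.Adj x y → g x = g y) (t : ℕ)
    (ht : ∀ v, Nat.card {x // g x = g v} ≤ t) : H.tauMax ≤ t := by
  rcases isEmpty_or_nonempty H.ConnectedComponent with h | h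
  · simp [tauMax, Set.range_eq_empty]
  refine csSup_le (Set.range_nonempty _) ?_
  rintro _ ⟨c, rfl⟩
  induction c using ConnectedComponent.ind with | _ v
  refine le_trans ?_ (ht v)
  exact Nat.card_le_card_of_injective
    (fun x => ⟨x.1, eq_of_reachable hg (ConnectedComponent.exact x.2)⟩)
    fun x y hxy => Subtype.ext (by simpa using hxy)

end Components

section Cuts

variable {V : Type*} [Fintype V] {G : SimpleGraph V}

lemma tenacity_le_of_isVertexCut {X : Finset V} (h : G.IsVertexCut X) :
    G.tenacity ≤ ((X.card : ℝ) + (G.delVerts X).tauMax) / (G.delVerts X).omegaComp := by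
  refine csInf_le ⟨0, ?_⟩ ⟨X, h, rfl⟩
  rintro _ ⟨Y, -, rfl⟩
  positivity

variable [DecidableEq V]

/-- If `g` is constant on the edges inside `S`, with fibres on `S` of size at most `t`, and is
injective on `B ⊆ S`, then deleting the complement of `S` leaves at least `|B|` components of
order at most `t`. -/
lemma tenacity_le_of_map {S B : Finset V} {g : V → V} {t : ℕ} (hBS : B ⊆ S)
    (hB : 2 ≤ B.card) (hg : ∀ x ∈ S, ∀ y ∈ S, G.Adj x y → g x = g y)
    (hinj : Set.InjOn g B) (ht : ∀ v ∈ S, (S.filter fun x => g x = g v).card ≤ t) :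
    G.IsVertexCut Sᶜ ∧
      G.tenacity ≤ ((Fintype.card V : ℝ) - S.card + t) / B.card := by
  have hg' : ∀ x y, (G.delVerts Sᶜ).Adj x y → g x.1 = g y.1 := fun x y hxy =>
    hg _ (by simpa using x.2) _ (by simpa using y.2) hxy
  have hω : B.card ≤ (G.delVerts Sᶜ).omegaComp := by
    have := card_le_omegaComp hg' (B.subtype (· ∉ Sᶜ)) fun x hx y hy hxy => by
      simp only [SetLike.mem_coe, Finset.mem_subtype] at hx hy
      exact Subtype.ext (hinj hx hy hxy)
    rwa [Finset.card_subtype, Finset.filter_true_of_mem fun x hx => by simpa using hBS hx] at this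
  have hτ : (G.delVerts Sᶜ).tauMax ≤ t := by
    refine tauMax_le hg' t fun v => ?_
    refine le_trans ?_ (ht v (by simpa using v.2))
    rw [← Nat.card_eq_finsetCard]
    refine Nat.card_le_card_of_injective
      (fun x => ⟨x.1.1, by simpa using ⟨by simpa using x.1.2, x.2⟩⟩) fun x y hxy => ?_
    exact Subtype.ext (Subtype.ext (by simpa using hxy))
  have hcut : G.IsVertexCut Sᶜ := lt_of_lt_of_le hB hω
  refine ⟨hcut, (tenacity_le_of_isVertexCut hcut).trans ?_⟩
  have hX : (Sᶜ.card : ℝ) = Fintype.card V - S.card := by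
    rw [Finset.card_compl, Nat.cast_sub (Finset.card_le_univ S)]
  rw [hX]
  have : (0 : ℝ) < B.card := by exact_mod_cast (by omega : 0 < B.card)
  have : (S.card : ℝ) ≤ Fintype.card V := by exact_mod_cast Finset.card_le_univ S
  have : ((G.delVerts Sᶜ).tauMax : ℝ) ≤ t := by exact_mod_cast hτ
  gcongr

lemma tenacity_le_of_isIndepSet {S : Finset V} (hS : 2 ≤ S.card)
    (hind : ∀ x ∈ S, ∀ y ∈ S, ¬ G.Adj x y) :
    G.IsVertexCut Sᶜ ∧ G.tenacity ≤ ((Fintype.card V : ℝ) - S.card + 1) / S.card := by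
  have := tenacity_le_of_map (G := G) (g := id) (t := 1) (Finset.Subset.refl S) hS
    (fun x hx y hy h => (hind x hx y hy h).elim) (Set.injOn_id _)
    (fun v hv => Finset.card_le_one.2 (by simp +contextual))
  simpa using this

end Cuts

section CycleGraph

open Fin.CommRing in
lemma omegaComp_delVerts_cycleGraph_le {n : ℕ} {X : Finset (Fin (n + 2))}
    (h : (cycleGraph (n + 2)).IsVertexCut X) :
    ((cycleGraph (n + 2)).delVerts X).omegaComp ≤ X.card := by
  set H := (cycleGraph (n + 2)).delVerts X with hH
  have key : ∀ c : H.ConnectedComponent, ∃ v, H.connectedComponentMk v = c ∧ v.1 + 1 ∈ X := by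
    intro c
    by_contra! hc
    induction c using ConnectedComponent.ind with | _ v
    have step : ∀ m : ℕ, ∃ hm : v.1 + (m : Fin (n + 2)) ∉ X,
        H.connectedComponentMk ⟨_, hm⟩ = H.connectedComponentMk v := by
      intro m
      induction m with
      | zero => exact ⟨by simpa using v.2, by simp⟩
      | succ m ih =>
        obtain ⟨hm, he⟩ := ih
        have h1 := hc _ he
        have h2 : v.1 + ((m + 1 : ℕ) : Fin (n + 2)) ∉ X := by
          rwa [Nat.cast_succ, ← add_assoc]
        refine ⟨h2, Eq.trans (ConnectedComponent.sound (Adj.reachable ?_)) he⟩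
        change (cycleGraph (n + 2)).Adj _ _
        rw [cycleGraph_adj]
        left
        push_cast
        abel
    have : H.omegaComp ≤ 1 := by
      refine Finite.card_le_one_iff_subsingleton.2 ⟨fun a b => ?_⟩
      have : ∀ a : H.ConnectedComponent, a = H.connectedComponentMk v := by
        intro a
        induction a using ConnectedComponent.ind with | _ u
        obtain ⟨hm, he⟩ := step (u.1 - v.1).val
        rw [← he]
        congr 1
        exact Subtype.ext (by simp)
      rw [this a, this b]
    exact absurd h this.not_gt
  choose f hf hfX using key
  rw [omegaComp, ← Nat.card_eq_finsetCard]
  refine Nat.card_le_card_of_injective (fun c => ⟨(f c).1 + 1, hfX c⟩) fun c d hcd => ?_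
  have : f c = f d := Subtype.ext (by simpa using hcd)
  rw [← hf c, ← hf d, this]

lemma tenacity_cycleGraph_odd {k : ℕ} (hk : 2 ≤ k) :
    (cycleGraph (2 * k + 1)).tenacity = ((k : ℝ) + 2) / k := by
  have hk0 : (0 : ℝ) < k := by exact_mod_cast (by omega : 0 < k)
  have hcut : ∃ X, (cycleGraph (2 * k + 1)).IsVertexCut X ∧
      (cycleGraph (2 * k + 1)).tenacity ≤ ((k : ℝ) + 2) / k := by
    let e : Fin k ↪ Fin (2 * k + 1) :=
      ⟨fun i => ⟨2 * i.1 + 1, by omega⟩, fun i j h => by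
        simp only [Fin.mk.injEq] at h
        exact Fin.ext (by omega)⟩
    have hcard : (Finset.univ.map e).card = k := by simp
    have := tenacity_le_of_isIndepSet (G := cycleGraph (2 * k + 1)) (S := Finset.univ.map e)
      (by omega) (by
        intro x hx y hy hxy
        simp only [Finset.mem_map, Finset.mem_univ, true_and] at hx hy
        obtain ⟨i, rfl⟩ := hx
        obtain ⟨j, rfl⟩ := hy
        rw [cycleGraph_adj'] at hxy
        simp only [e, Fin.sub_def] at hxy
        have aux : ∀ i j : Fin k,
            (2 * k + 1 - (2 * j.1 + 1) + (2 * i.1 + 1)) % (2 * k + 1) ≠ 1 := by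
          intro i j h
          rcases Nat.lt_or_ge i.1 j.1 with hij | hij
          · rw [Nat.mod_eq_of_lt (by omega)] at h
            omega
          · rw [Nat.mod_eq_sub_mod (by omega), Nat.mod_eq_of_lt (by omega)] at h
            omega
        exact hxy.elim (aux i j) (aux j i))
    refine ⟨_, this.1, this.2.trans_eq ?_⟩
    rw [hcard]
    simp
    ring
  obtain ⟨X, hX, hle⟩ := hcut
  refine le_antisymm hle (le_csInf ⟨_, X, hX, rfl⟩ ?_)
  rintro _ ⟨Y, hY, rfl⟩
  obtain ⟨m, rfl⟩ : ∃ m, k = m + 1 := ⟨k - 1, by omega⟩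
  have h1 := omegaComp_delVerts_cycleGraph_le (n := 2 * m + 1) hY
  have h2 := card_le_omegaComp_mul_tauMax ((cycleGraph (2 * (m + 1) + 1)).delVerts Y)
  have h3 := omegaComp_le_card ((cycleGraph (2 * (m + 1) + 1)).delVerts Y)
  have h4 := one_le_tauMax _ hY
  have h5 : Nat.card {v // v ∉ Y} = 2 * (m + 1) + 1 - Y.card := by
    simp [Nat.card_eq_fintype_card, Fintype.card_subtype_compl]
  have h6 : 1 < ((cycleGraph (2 * (m + 1) + 1)).delVerts Y).omegaComp := hY
  have h7 : Y.card ≤ 2 * (m + 1) + 1 := by simpa using Finset.card_le_univ Y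
  rw [h5] at h2 h3
  change ((cycleGraph (2 * (m + 1) + 1)).delVerts Y).omegaComp ≤ _ at h1
  generalize ((cycleGraph (2 * (m + 1) + 1)).delVerts Y).omegaComp = ω at *
  generalize ((cycleGraph (2 * (m + 1) + 1)).delVerts Y).tauMax = τ at *
  have hsum : ω + 2 ≤ Y.card + τ := by
    rcases h4.eq_or_lt with rfl | h4
    · omega
    · omega
  have hωk : ω ≤ m + 1 := by omega
  rw [div_le_div_iff₀ hk0 (by exact_mod_cast (by omega : 0 < ω))]
  have a1 : (ω : ℝ) ≤ (m + 1 : ℕ) := by exact_mod_cast hωk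
  have a2 : (ω : ℝ) + 2 ≤ Y.card + τ := by exact_mod_cast hsum
  nlinarith

end CycleGraph

section Acyclic

variable {V : Type*} {H : SimpleGraph V}

/-- A nonempty finite set of vertices of a forest contains a vertex with at most one neighbour
in that set. -/
lemma IsAcyclic.exists_mem_forall_adj_eq (hH : H.IsAcyclic) {D : Finset V} (hD : D.Nonempty) :
    ∃ l ∈ D, ∀ x ∈ D, ∀ y ∈ D, H.Adj l x → H.Adj l y → x = y := by
  classical
  obtain ⟨d, hd⟩ := hD
  let K := H.induce (D : Set V)
  let c := K.connectedComponentMk ⟨d, hd⟩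
  have hT : c.toSimpleGraph.IsTree := (hH.induce _).isTree_connectedComponent c
  have hmem : ∀ (l : c) (x : V) (hx : x ∈ D), H.Adj l.1.1 x →
      ∃ h : (⟨x, hx⟩ : (D : Set V)) ∈ c.supp, c.toSimpleGraph.Adj l ⟨⟨x, hx⟩, h⟩ := by
    intro l x hx hadj
    have hK : K.Adj l.1 ⟨x, hx⟩ := hadj
    exact ⟨(ConnectedComponent.mem_supp_congr_adj c hK).1 l.2, hK⟩
  have : Fintype c := Fintype.ofFinite _
  obtain ⟨l, hl⟩ : ∃ l : c, ∀ x y, c.toSimpleGraph.Adj l x → c.toSimpleGraph.Adj l y → x = y := by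
    rcases subsingleton_or_nontrivial c with h | h
    · exact ⟨⟨⟨d, hd⟩, rfl⟩, fun x y _ _ => Subsingleton.elim _ _⟩
    · obtain ⟨l, hl⟩ := hT.exists_vert_degree_one_of_nontrivial
      obtain ⟨z, hz⟩ := degree_eq_one_iff_existsUnique_adj.1 hl
      exact ⟨l, fun x y hx hy => (hz.2 x hx).trans (hz.2 y hy).symm⟩
  refine ⟨l.1.1, l.1.2, fun x hx y hy hlx hly => ?_⟩
  obtain ⟨_, h1⟩ := hmem l x hx hlx
  obtain ⟨_, h2⟩ := hmem l y hy hly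
  simpa using hl _ _ h1 h2

lemma IsAcyclic.exists_bool_coloring (hH : H.IsAcyclic) :
    ∃ f : V → Bool, ∀ x y, H.Adj x y → f x ≠ f y := by
  obtain ⟨f⟩ := hH.colorable_two
  exact ⟨fun v => finTwoEquiv (f v), fun x y h e => f.valid h (finTwoEquiv.injective e)⟩

/-- A nonempty finite set `D` of vertices of a forest contains an independent set `B` with more
than half of the vertices, or with exactly half of them and such that some further vertex `l` of
`D` has at most one neighbour in `D`, this neighbour belonging to `B`. -/
lemma IsAcyclic.exists_half (hH : H.IsAcyclic) {D : Finset V} (hD : D.Nonempty) :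
    ∃ B ⊆ D, (∀ x ∈ B, ∀ y ∈ B, ¬ H.Adj x y) ∧ (D.card < 2 * B.card ∨
      (2 * B.card = D.card ∧ ∃ l ∈ D, l ∉ B ∧ ∃ b ∈ B, ∀ x ∈ D, H.Adj l x → x = b)) := by
  classical
  obtain ⟨f, hf⟩ := hH.exists_bool_coloring
  obtain ⟨l, hlD, hl⟩ := hH.exists_mem_forall_adj_eq hD
  have hind : ∀ b : Bool, ∀ x ∈ D.filter (f · = b), ∀ y ∈ D.filter (f · = b), ¬ H.Adj x y := by
    intro b x hx y hy hxy
    exact hf x y hxy ((Finset.mem_filter.1 hx).2.trans (Finset.mem_filter.1 hy).2.symm)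
  have hsum := Finset.card_filter_add_card_filter_not (s := D) (f · = f l)
  have hnot : D.filter (¬ f · = f l) = D.filter (f · = !f l) := by
    ext x
    cases f x <;> cases f l <;> simp
  rw [hnot] at hsum
  by_cases h1 : D.card < 2 * (D.filter (f · = f l)).card
  · exact ⟨_, Finset.filter_subset _ _, hind _, Or.inl h1⟩
  refine ⟨D.filter (f · = !f l), Finset.filter_subset _ _, hind _, ?_⟩
  by_cases h2 : D.card < 2 * (D.filter (f · = !f l)).card
  · exact Or.inl h2
  have hpos := hD.card_pos
  refine Or.inr ⟨by omega, l, hlD, by simp, ?_⟩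
  by_cases hx : ∃ x ∈ D, H.Adj l x
  · obtain ⟨x, hxD, hx⟩ := hx
    refine ⟨x, ?_, fun y hy hly => hl y hy x hxD hly hx⟩
    have := hf _ _ hx
    simp only [Finset.mem_filter, hxD, true_and]
    revert this
    cases f x <;> cases f l <;> simp
  · obtain ⟨b, hb⟩ : (D.filter (f · = !f l)).Nonempty := Finset.card_pos.1 (by omega)
    exact ⟨b, hb, fun x hxD hlx => (hx ⟨x, hxD, hlx⟩).elim⟩

end Acyclic

section Unicyclic

variable {V : Type*} [Fintype V] {G : SimpleGraph V}

lemma Unicyclic.not_isAcyclic (hG : G.Unicyclic) : ¬ G.IsAcyclic := fun h => by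
  have := (isTree_iff_connected_and_card.1 ⟨hG.1, h⟩).2
  rw [hG.2, Nat.card_eq_fintype_card] at this
  omega

lemma Unicyclic.isAcyclic_deleteEdges (hG : G.Unicyclic) {a b : V} (hab : G.Adj a b)
    (h : ¬ G.IsBridge s(a, b)) : (G.deleteEdges {s(a, b)}).IsAcyclic := by
  refine (isTree_iff_connected_and_card.2
    ⟨hG.1.connected_delete_edge_of_not_isBridge h, ?_⟩).isAcyclic
  rw [edgeSet_deleteEdges, Nat.card_eq_fintype_card (α := V), ← hG.2,
    Nat.card_coe_set_eq, Nat.card_coe_set_eq]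
  exact Set.ncard_sdiff_singleton_add_one (by simpa using hab)

lemma card_edgeSet_cycleGraph {n : ℕ} (hn : 3 ≤ n) : Nat.card (cycleGraph n).edgeSet = n := by
  obtain ⟨m, rfl⟩ : ∃ m, n = m + 3 := ⟨n - 3, by omega⟩
  have := (cycleGraph (m + 3)).sum_degrees_eq_twice_card_edges
  simp only [cycleGraph_degree_three_le, Finset.sum_const, Finset.card_univ, Fintype.card_fin,
    smul_eq_mul] at this
  rw [Nat.card_eq_fintype_card, ← edgeFinset_card]
  omega

lemma Unicyclic.nonempty_iso_cycleGraph (hG : G.Unicyclic) {v : V} {p : G.Walk v v}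
    (hp : p.IsCycle) (hlen : p.length = Fintype.card V) :
    Nonempty (G ≃g cycleGraph (Fintype.card V)) := by
  have h3 := hp.three_le_length
  obtain ⟨φ⟩ := (cycleGraph_isContained_iff (G := G) (n := Fintype.card V) (by omega)).2
    ⟨v, p, hp, hlen⟩
  have hbij : Function.Bijective φ.toHom :=
    (Fintype.bijective_iff_injective_and_card _).2 ⟨φ.injective, by simp⟩
  let e : Fin (Fintype.card V) ≃ V := Equiv.ofBijective _ hbij
  have hle : (cycleGraph (Fintype.card V)).map e ≤ G :=
    (map_le_iff_le_comap e.toEmbedding _ _).2 fun a b hab => φ.toHom.map_adj hab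
  have heq : (cycleGraph (Fintype.card V)).map e = G := by
    rw [← edgeSet_inj]
    refine Set.eq_of_subset_of_ncard_le (edgeSet_mono hle) ?_ (Set.toFinite _)
    rw [← Nat.card_coe_set_eq, ← Nat.card_coe_set_eq, hG.2,
      ← Nat.card_congr (Iso.map e (cycleGraph (Fintype.card V))).mapEdgeSet,
      card_edgeSet_cycleGraph (by omega)]
  exact ⟨(heq ▸ Iso.map e (cycleGraph (Fintype.card V))).symm⟩

/-- In a unicyclic graph other than a cycle, some vertex `c` is such that the graph with `c` deleted
is a forest (contained in the forest `H`) and is disconnected: `D` is a proper nonempty subset of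
its vertices that is closed under adjacency. -/
lemma Unicyclic.exists_separation (hG : G.Unicyclic)
    (hnc : IsEmpty (G ≃g cycleGraph (Fintype.card V))) :
    ∃ (H : SimpleGraph V) (c : V) (D : Finset V), H.IsAcyclic ∧
      (∀ x y, x ≠ c → y ≠ c → G.Adj x y → H.Adj x y) ∧ c ∉ D ∧ D.Nonempty ∧
      (∃ r, r ≠ c ∧ r ∉ D) ∧ ∀ x ∈ D, ∀ y, y ≠ c → G.Adj x y → y ∈ D := by
  classical
  obtain ⟨v, p, hp⟩ : ∃ (v : V) (p : G.Walk v v), p.IsCycle := by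
    simpa [IsAcyclic] using hG.not_isAcyclic
  have hout : ∃ u, u ∉ p.support := by
    by_contra! hall
    refine not_nonempty_iff.2 hnc (hG.nonempty_iso_cycleGraph hp ?_)
    have h1 : p.support.tail.toFinset = Finset.univ := by
      ext u
      simp only [List.mem_toFinset, Finset.mem_univ, iff_true]
      have := hall u
      rw [← p.cons_tail_support, List.mem_cons] at this
      rcases this with rfl | h
      · exact p.end_mem_tail_support hp.not_nil
      · exact h
    have h2 := List.toFinset_card_of_nodup hp.support_nodup
    rw [h1, Finset.card_univ] at h2
    simp [h2]
  obtain ⟨u, hu⟩ := hout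
  obtain ⟨q⟩ := hG.1.preconnected v u
  obtain ⟨d, -, hc, hw⟩ := q.exists_boundary_dart {x | x ∈ p.support} p.start_mem_support hu
  obtain ⟨⟨c, w⟩, hcw⟩ := d
  simp only [Set.mem_ofPred_eq] at hc hw
  have hp' := hp.rotate hc
  have hw' : w ∉ (p.rotate c hc).support := by
    rwa [Walk.mem_support_rotate_iff]
  generalize p.rotate c hc = p' at hp' hw'
  have hnil := hp'.not_nil
  have hsnd := p'.adj_snd hnil
  have hpen := p'.adj_penultimate hnil
  have hne := hp'.snd_ne_penultimate
  have hsw : p'.snd ≠ w := fun h => hw' (h ▸ p'.getVert_mem_support 1)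
  have hpw : p'.penultimate ≠ w := fun h => hw' (h ▸ p'.getVert_mem_support _)
  have hacyc := hG.isAcyclic_deleteEdges hpen fun hb =>
    (isBridge_iff_forall_cycle_notMem (by simpa using hpen)).1 hb p' hp'
      (p'.mk_penultimate_end_mem_edges hnil)
  generalize p'.snd = a at *
  generalize p'.penultimate = b at *
  set H := G.deleteEdges {s(b, c)} with hH
  have hHcw : H.Adj c w := by
    rw [hH, deleteEdges_adj]
    refine ⟨hcw, ?_⟩
    simp only [Set.mem_singleton_iff, Sym2.eq_iff]
    grind
  have hbr : ¬ (H.deleteEdges {s(c, w)}).Reachable c w :=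
    isBridge_iff.1 (isAcyclic_iff_forall_adj_isBridge.1 hacyc hHcw)
  have hac : (H.deleteEdges {s(c, w)}).Adj c a := by
    simp only [hH, deleteEdges_adj, Set.mem_singleton_iff, Sym2.eq_iff]
    have := hsnd.ne
    grind
  refine ⟨H, c, Finset.univ.filter fun x => (H.deleteEdges {s(c, w)}).Reachable x w, hacyc,
    ?_, by simpa using hbr, ⟨w, by simp⟩, ⟨a, hac.ne', ?_⟩, ?_⟩
  · intro x y hx hy hxy
    simp only [hH, deleteEdges_adj, Set.mem_singleton_iff, Sym2.eq_iff]
    grind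
  · simp only [Finset.mem_filter, Finset.mem_univ, true_and]
    exact fun h => hbr (hac.reachable.trans h)
  · intro x hx y hy hxy
    simp only [Finset.mem_filter, Finset.mem_univ, true_and] at hx ⊢
    have hxc : x ≠ c := by
      rintro rfl
      exact hbr hx
    refine Reachable.trans (Adj.reachable ?_) hx
    simp only [hH, deleteEdges_adj, Set.mem_singleton_iff, Sym2.eq_iff]
    have := hxy.symm
    grind

lemma Unicyclic.tenacity_lt (hG : G.Unicyclic) {k : ℕ} (hk : 2 ≤ k)
    (hcard : Fintype.card V = 2 * k + 1)
    (hnc : IsEmpty (G ≃g cycleGraph (Fintype.card V))) :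
    G.tenacity < ((k : ℝ) + 2) / k := by
  classical
  obtain ⟨H, c, D, hH, hGH, hcD, hD, ⟨r, hrc, hrD⟩, hclosed⟩ := hG.exists_separation hnc
  have hk0 : (0 : ℝ) < k := by exact_mod_cast (by omega : 0 < k)
  set R := (insert c D)ᶜ with hR
  have hmemR : ∀ x, x ∈ R ↔ x ≠ c ∧ x ∉ D := by simp [hR]
  have hsize : D.card + R.card = 2 * k := by
    rw [hR, Finset.card_compl, Finset.card_insert_of_notMem hcD, hcard]
    have := Finset.card_le_univ (insert c D)
    rw [Finset.card_insert_of_notMem hcD, hcard] at this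
    omega
  obtain ⟨B₁, hB₁, hi₁, h₁⟩ := hH.exists_half hD
  obtain ⟨B₂, hB₂, hi₂, h₂⟩ := hH.exists_half (D := R) ⟨r, (hmemR r).2 ⟨hrc, hrD⟩⟩
  have hdisj : Disjoint B₁ B₂ := Finset.disjoint_left.2 fun x h1 h2 =>
    ((hmemR x).1 (hB₂ h2)).2 (hB₁ h1)
  have hBcard := Finset.card_union_of_disjoint hdisj
  have hDc : ∀ x ∈ D, x ≠ c := fun x hx h => hcD (h ▸ hx)
  have hind : ∀ x ∈ B₁ ∪ B₂, ∀ y ∈ B₁ ∪ B₂, ¬ G.Adj x y := by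
    intro x hx y hy hxy
    have := hxy.symm
    grind
  by_cases hbig : k + 1 ≤ (B₁ ∪ B₂).card
  · refine (tenacity_le_of_isIndepSet (by omega) hind).2.trans_lt ?_
    have : (k : ℝ) + 1 ≤ (B₁ ∪ B₂).card := by exact_mod_cast hbig
    rw [hcard, div_lt_div_iff₀ (by linarith) hk0]
    push_cast
    nlinarith
  obtain ⟨e₁, l₁, hl₁D, hl₁B, b₁, hb₁, hadj₁⟩ := h₁.resolve_left (by omega)
  obtain ⟨e₂, l₂, hl₂D, hl₂B, b₂, hb₂, hadj₂⟩ := h₂.resolve_left (by omega)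
  have hl : l₁ ≠ l₂ := fun h => ((hmemR l₂).1 hl₂D).2 (h ▸ hl₁D)
  have hBk : (B₁ ∪ B₂).card = k := by omega
  let g : V → V := fun x => if x = l₁ then b₁ else if x = l₂ then b₂ else x
  have hl₁ : l₁ ∉ B₁ ∪ B₂ := by grind
  have hl₂ : l₂ ∉ B₁ ∪ B₂ := by grind
  have hgB : ∀ x ∈ B₁ ∪ B₂, g x = x := by grind
  have hScard : (insert l₁ (insert l₂ (B₁ ∪ B₂))).card = k + 2 := by
    rw [Finset.card_insert_of_notMem (by grind), Finset.card_insert_of_notMem hl₂, hBk]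
  have := tenacity_le_of_map (G := G) (S := insert l₁ (insert l₂ (B₁ ∪ B₂))) (B := B₁ ∪ B₂)
    (g := g) (t := 2) (by grind) (by omega) ?_ (fun x hx y hy hxy => by grind) ?_
  · refine this.2.trans_lt ?_
    rw [hcard, hScard, hBk]
    push_cast
    gcongr
    linarith
  · intro x hx y hy hxy
    have hyx := hxy.symm
    simp only [Finset.mem_insert] at hx hy
    grind
  · intro v hv
    refine (Finset.card_le_card (t := {g v, if g v ∈ D then l₁ else l₂}) ?_).trans
      Finset.card_le_two
    intro x hx
    simp only [Finset.mem_filter, Finset.mem_insert, Finset.mem_singleton] at hx hv ⊢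
    grind

end Unicyclic

end SimpleGraph

theorem unicyclic_odd_not_cycle (n : ℕ) (hodd : Odd n)
    (G : SimpleGraph (Fin n)) (hG : G.Unicyclic)
    (hnc : IsEmpty (G ≃g SimpleGraph.cycleGraph n)) :
    G.tenacity < ((n : ℝ) + 3) / ((n : ℝ) - 1) ∧
      (SimpleGraph.cycleGraph n).tenacity = ((n : ℝ) + 3) / ((n : ℝ) - 1) := by
  obtain ⟨k, rfl⟩ := hodd
  have hnc' : IsEmpty (G ≃g cycleGraph (Fintype.card (Fin (2 * k + 1)))) := by
    rwa [Fintype.card_fin]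
  have hk : 2 ≤ k := by
    obtain ⟨v, p, hp⟩ : ∃ (v : _) (p : G.Walk v v), p.IsCycle := by
      simpa [IsAcyclic] using hG.not_isAcyclic
    have h3 := hp.three_le_length
    have hle : p.length ≤ 2 * k + 1 := by
      simpa using hp.support_nodup.length_le_card
    by_contra! hlt
    exact not_nonempty_iff.2 hnc' (hG.nonempty_iso_cycleGraph hp (by simp; omega))
  have hk0 : (0 : ℝ) < k := by exact_mod_cast (by omega : 0 < k)
  have heq : (((2 * k + 1 : ℕ) : ℝ) + 3) / (((2 * k + 1 : ℕ) : ℝ) - 1) = ((k : ℝ) + 2) / k := by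
    push_cast
    field_simp
    ring
  rw [heq]
  exact ⟨hG.tenacity_lt hk (by simp) hnc', tenacity_cycleGraph_odd hk⟩
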